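/- Let n ≥ 1, let J ∈ ℝ^{n×n} be skew-symmetric, and let R_d, Q ∈ ℝ^{n×n} be symmetric positive definite. Then every complex eigenvalue of the matrix (J − R_d) Q has strictly negative real part; consequently, every differentiable solution e : [0,∞) → ℝⁿ of the linear ODE ė = (J − R_d) Q e satisfies e(t) → 0 as t → ∞. -/

import Mathlib

open Matrix

theorem Matrix.PosDef.exists_pos_mul_le {n : ℕ} {P : Matrix (Fin n) (Fin n) ℝ} (hP : P.PosDef)
    (S : Matrix (Fin n) (Fin n) ℝ) :
    ∃ c > 0, ∀ x : Fin n → ℝ, c * (x ⬝ᵥ S *ᵥ x) ≤ x ⬝ᵥ P *ᵥ x := by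
  have hcont : ∀ T : Matrix (Fin n) (Fin n) ℝ, Continuous fun x : Fin n → ℝ => x ⬝ᵥ T *ᵥ x :=
    fun T => by fun_prop
  have hpos : ∀ x : Fin n → ℝ, x ≠ 0 → 0 < x ⬝ᵥ P *ᵥ x := fun x hx => by
    simpa using hP.dotProduct_mulVec_pos hx
  have hK : IsCompact (Metric.sphere (0 : Fin n → ℝ) 1) := isCompact_sphere 0 1
  obtain ⟨M, hM⟩ := hK.bddAbove_image
    (f := fun x => |x ⬝ᵥ S *ᵥ x| / (x ⬝ᵥ P *ᵥ x)) (by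
      refine (hcont S).abs.continuousOn.div (hcont P).continuousOn fun x hx => (hpos x ?_).ne'
      exact ne_zero_of_mem_unit_sphere ⟨x, hx⟩)
  refine ⟨(|M| + 1)⁻¹, by positivity, fun x => ?_⟩
  rcases eq_or_ne x 0 with rfl | hx
  · simp
  have hn : ‖x‖ ≠ 0 := norm_ne_zero_iff.mpr hx
  have hmem : ‖x‖⁻¹ • x ∈ Metric.sphere (0 : Fin n → ℝ) 1 := by
    simp [norm_smul, hn]
  have hle := hM (Set.mem_image_of_mem _ hmem)
  have hscale : ∀ T : Matrix (Fin n) (Fin n) ℝ,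
      (‖x‖⁻¹ • x) ⬝ᵥ T *ᵥ (‖x‖⁻¹ • x) = (‖x‖⁻¹ ^ 2) * (x ⬝ᵥ T *ᵥ x) := fun T => by
    simp only [mulVec_smul, smul_dotProduct, dotProduct_smul, smul_eq_mul]; ring
  have hr : 0 < ‖x‖⁻¹ ^ 2 := by positivity
  simp only [hscale, abs_mul, abs_of_pos hr] at hle
  rw [mul_div_mul_left _ _ hr.ne', div_le_iff₀ (hpos x hx)] at hle
  rw [inv_mul_le_iff₀ (by positivity)]
  nlinarith [le_abs_self (x ⬝ᵥ S *ᵥ x), le_abs_self M, hpos x hx]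

theorem Matrix.dotProduct_mulVec_self_eq_zero_of_transpose_eq_neg {n : ℕ}
    {J : Matrix (Fin n) (Fin n) ℝ} (hJ : Jᵀ = -J) (x : Fin n → ℝ) : x ⬝ᵥ J *ᵥ x = 0 := by
  have h : x ⬝ᵥ J *ᵥ x = x ⬝ᵥ Jᵀ *ᵥ x := by
    rw [mulVec_transpose, dotProduct_comm x (x ᵥ* J), dotProduct_mulVec]
  rw [hJ, neg_mulVec, dotProduct_neg] at h
  linarith

theorem Matrix.IsSymm.dotProduct_mulVec_comm {n : ℕ} {Q : Matrix (Fin n) (Fin n) ℝ}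
    (hQ : Q.IsSymm) (x y : Fin n → ℝ) : x ⬝ᵥ Q *ᵥ y = y ⬝ᵥ Q *ᵥ x := by
  rw [dotProduct_mulVec, ← mulVec_transpose, hQ.eq, dotProduct_comm]

theorem Matrix.dotProduct_mulVec_sub_mul_mulVec {n : ℕ} {J R Q : Matrix (Fin n) (Fin n) ℝ}
    (hJ : Jᵀ = -J) (hQ : Q.IsSymm) (x : Fin n → ℝ) :
    x ⬝ᵥ Q *ᵥ (((J - R) * Q) *ᵥ x) = -(x ⬝ᵥ (Qᵀ * R * Q) *ᵥ x) := by
  have h := dotProduct_mulVec_self_eq_zero_of_transpose_eq_neg hJ (Q *ᵥ x)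
  rw [← mulVec_mulVec, sub_mulVec, mulVec_sub, dotProduct_sub, ← mulVec_mulVec, ← mulVec_mulVec,
    hQ.eq, hQ.dotProduct_mulVec_comm x (J *ᵥ _), dotProduct_comm (J *ᵥ _), h, zero_sub]

theorem Matrix.PosDef.transpose_mul_mul_of_posDef {n : ℕ} {R Q : Matrix (Fin n) (Fin n) ℝ}
    (hR : R.PosDef) (hQ : Q.PosDef) : (Qᵀ * R * Q).PosDef := by
  have h := hR.conjTranspose_mul_mul_same (B := Q) (mulVec_injective_of_isUnit hQ.isUnit)
  rwa [conjTranspose_eq_transpose_of_trivial] at h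

theorem Matrix.exists_real_eigenpair_of_mem_spectrum {n : ℕ} {A : Matrix (Fin n) (Fin n) ℝ}
    {μ : ℂ} (hμ : μ ∈ spectrum ℂ (A.map (algebraMap ℝ ℂ))) :
    ∃ x y : Fin n → ℝ, (x ≠ 0 ∨ y ≠ 0) ∧ A *ᵥ x = μ.re • x - μ.im • y ∧
      A *ᵥ y = μ.re • y + μ.im • x := by
  rw [← Matrix.spectrum_toLin', ← Module.End.hasEigenvalue_iff_mem_spectrum] at hμ
  obtain ⟨v, hv⟩ := hμ.exists_hasEigenvector
  have hAv : A.map (algebraMap ℝ ℂ) *ᵥ v = μ • v := by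
    simpa using hv.apply_eq_smul
  refine ⟨fun i => (v i).re, fun i => (v i).im, ?_, ?_, ?_⟩
  · by_contra! h
    exact hv.2 (funext fun i => Complex.ext (congrFun h.1 i) (congrFun h.2 i))
  · ext i
    simpa [mulVec, dotProduct] using congrArg Complex.re (congrFun hAv i)
  · ext i
    simpa [mulVec, dotProduct] using congrArg Complex.im (congrFun hAv i)

theorem HasDerivAt.dotProduct_mulVec_self {n : ℕ} {Q : Matrix (Fin n) (Fin n) ℝ}
    (hQ : Q.IsSymm) {e : ℝ → Fin n → ℝ} {e' : Fin n → ℝ} {t : ℝ} (he : HasDerivAt e e' t) :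
    HasDerivAt (fun s => e s ⬝ᵥ Q *ᵥ e s) (2 * (e t ⬝ᵥ Q *ᵥ e')) t := by
  have hQe : HasDerivAt (fun s => Q *ᵥ e s) (Q *ᵥ e') t :=
    (LinearMap.toContinuousLinearMap Q.mulVecLin).hasFDerivAt.comp_hasDerivAt t he
  have h := HasDerivAt.fun_sum (u := Finset.univ) fun i _ =>
    (hasDerivAt_pi.mp he i).mul (hasDerivAt_pi.mp hQe i)
  have hsum : 2 * (e t ⬝ᵥ Q *ᵥ e') = ∑ i, (e' i * (Q *ᵥ e t) i + e t i * (Q *ᵥ e') i) := by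
    rw [Finset.sum_add_distrib]
    change _ = e' ⬝ᵥ Q *ᵥ e t + e t ⬝ᵥ Q *ᵥ e'
    rw [hQ.dotProduct_mulVec_comm e']
    ring
  rw [hsum]
  exact h

theorem tendsto_zero_of_hasDerivAt_le_neg_mul {V V' : ℝ → ℝ} {k : ℝ} (hk : 0 < k)
    (hV : ∀ t, 0 ≤ V t) (hderiv : ∀ t ∈ Set.Ici (0 : ℝ), HasDerivAt V (V' t) t)
    (hle : ∀ t ∈ Set.Ici (0 : ℝ), V' t ≤ -k * V t) :
    Filter.Tendsto V Filter.atTop (nhds 0) := by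
  have hd : ∀ t ∈ Set.Ici (0 : ℝ), HasDerivAt (fun s => Real.exp (k * s) * V s)
      (Real.exp (k * t) * k * V t + Real.exp (k * t) * V' t) t := fun t ht => by
    have h := ((hasDerivAt_id t).const_mul k).exp.fun_mul (hderiv t ht)
    simpa using h
  have hanti : AntitoneOn (fun s => Real.exp (k * s) * V s) (Set.Ici 0) := by
    refine antitoneOn_of_deriv_nonpos (convex_Ici 0)
      (fun t ht => (hd t ht).continuousAt.continuousWithinAt)
      (fun t ht => (hd t (interior_subset ht)).differentiableAt.differentiableWithinAt)
      fun t ht => ?_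
    rw [(hd t (interior_subset ht)).deriv]
    nlinarith [hle t (interior_subset ht), Real.exp_pos (k * t)]
  have hlim : Filter.Tendsto (fun t => V 0 * Real.exp (-(k * t))) Filter.atTop (nhds 0) := by
    simpa using (Real.tendsto_exp_neg_atTop_nhds_zero.comp
      (Filter.tendsto_id.const_mul_atTop hk)).const_mul (V 0)
  refine tendsto_of_tendsto_of_tendsto_of_le_of_le' tendsto_const_nhds hlim
    (Filter.Eventually.of_forall hV) ?_
  filter_upwards [Filter.eventually_ge_atTop 0] with t ht
  have h := hanti (Set.mem_Ici.mpr le_rfl) (Set.mem_Ici.mpr ht) ht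
  simp only [mul_zero, Real.exp_zero, one_mul] at h
  rwa [Real.exp_neg, ← div_eq_mul_inv, le_div_iff₀ (Real.exp_pos _), mul_comm]

/-- If `J` is skew-symmetric and `R_d, Q` are symmetric positive
definite, then every complex eigenvalue of `(J − R_d)Q` has strictly negative real
part; consequently every differentiable solution of `ė = (J − R_d)Q e` on `[0,∞)`
tends to `0`. -/
theorem stmt17 (n : ℕ) (hn : 1 ≤ n)
    (J Rd Q : Matrix (Fin n) (Fin n) ℝ) (hJ : Jᵀ = -J)
    (hRd : Rd.PosDef) (hQ : Q.PosDef) :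
    (∀ μ ∈ spectrum ℂ (((J - Rd) * Q).map (algebraMap ℝ ℂ)), μ.re < 0) ∧
    (∀ e : ℝ → Fin n → ℝ, Differentiable ℝ e →
      (∀ t ∈ Set.Ici (0:ℝ), deriv e t = ((J - Rd) * Q).mulVec (e t)) →
      Filter.Tendsto e Filter.atTop (nhds 0)) := by
  have hsymm : Q.IsSymm := by
    simpa [IsHermitian, IsSymm, conjTranspose_eq_transpose_of_trivial] using hQ.isHermitian
  have hW := hRd.transpose_mul_mul_of_posDef hQ
  have hnonneg : ∀ {P : Matrix (Fin n) (Fin n) ℝ}, P.PosDef → ∀ x, 0 ≤ x ⬝ᵥ P *ᵥ x :=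
    fun hP x => by simpa using hP.posSemidef.dotProduct_mulVec_nonneg x
  have hpos : ∀ {P : Matrix (Fin n) (Fin n) ℝ}, P.PosDef → ∀ {x}, x ≠ 0 → 0 < x ⬝ᵥ P *ᵥ x :=
    fun hP x hx => by simpa using hP.dotProduct_mulVec_pos hx
  refine ⟨fun μ hμ => ?_, fun e he hode => ?_⟩
  · obtain ⟨x, y, hxy, hx, hy⟩ := exists_real_eigenpair_of_mem_spectrum hμ
    have h1 := dotProduct_mulVec_sub_mul_mulVec (R := Rd) hJ hsymm x
    have h2 := dotProduct_mulVec_sub_mul_mulVec (R := Rd) hJ hsymm y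
    rw [hx, mulVec_sub, mulVec_smul, mulVec_smul, dotProduct_sub, dotProduct_smul,
      dotProduct_smul, smul_eq_mul, smul_eq_mul] at h1
    rw [hy, mulVec_add, mulVec_smul, mulVec_smul, dotProduct_add, dotProduct_smul,
      dotProduct_smul, smul_eq_mul, smul_eq_mul, hsymm.dotProduct_mulVec_comm y x] at h2
    have hsum : μ.re * (x ⬝ᵥ Q *ᵥ x + y ⬝ᵥ Q *ᵥ y) < 0 := by
      rcases hxy with h | h
      · linarith [hpos hW h, hnonneg hW y]
      · linarith [hpos hW h, hnonneg hW x]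
    exact neg_of_mul_neg_left hsum (add_nonneg (hnonneg hQ x) (hnonneg hQ y))
  · obtain ⟨c, hc, hcle⟩ := hW.exists_pos_mul_le Q
    obtain ⟨d, hd, hdle⟩ := hQ.exists_pos_mul_le 1
    have hV : Filter.Tendsto (fun t => e t ⬝ᵥ Q *ᵥ e t) Filter.atTop (nhds 0) := by
      refine tendsto_zero_of_hasDerivAt_le_neg_mul (k := 2 * c) (by positivity)
        (fun t => hnonneg hQ _)
        (fun t _ => (he t).hasDerivAt.dotProduct_mulVec_self hsymm) fun t ht => ?_
      rw [hode t ht, dotProduct_mulVec_sub_mul_mulVec hJ hsymm]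
      linarith [hcle (e t)]
    refine tendsto_pi_nhds.mpr fun i => ?_
    have hsq : Filter.Tendsto (fun t => e t i ^ 2) Filter.atTop (nhds 0) := by
      refine squeeze_zero (fun t => sq_nonneg _) (fun t => ?_) (by simpa using hV.const_mul d⁻¹)
      rw [le_inv_mul_iff₀ hd]
      refine le_trans (mul_le_mul_of_nonneg_left ?_ hd.le) (hdle (e t))
      rw [one_mulVec, sq]
      exact Finset.single_le_sum (f := fun j => e t j * e t j)
        (fun j _ => mul_self_nonneg _) (Finset.mem_univ i)
    simpa [Real.sqrt_sq_eq_abs, tendsto_zero_iff_abs_tendsto_zero, Function.comp_def] using hsq.sqrt
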